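/- Let the $\mathcal P$-adic partial sums $S_N(x) = \sum_{\bar n < \tilde N} a_{\bar n} \chi^{\mathcal P}_{\bar n}(x)$ of a multiple generalized Haar series converge almost everywhere on $[0,1]^d$ to a function $f$, where $\sup_{i,j} p^j_i < \infty$. Suppose there exists a sequence $\{h_m\}$ satisfying conditions (h1)–(h3) on $[0,1]^d$ such that $\lim_{m \to \infty} \int_{\{x \in [0,1]^d : \Psi^*(x) > h_m(x)\}} h_m(x)\,dx = 0$, where $\Psi^*(x) = \sup_N |S_N(x)|$. Then for every $\bar n \in \mathbb Z_+^d$, $a_{\bar n} = \lim_{m \to \infty} \int_{[0,1]^d} \left[ f(x)\, \overline{\chi^{\mathcal P}_{\bar n}(x)} \right]_{h^{\bar n}_m(x)} dx$, where $h^{\bar n}_m(x) = \|\chi^{\mathcal P}_{\bar n}\|_\infty\, h_m(x)$. -/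

import Mathlib

open MeasureTheory Filter Topology

noncomputable section

/-- `mseq p k = ∏_{i<k} p i`, i.e. `m_k = p_1 ⋯ p_k` (Lean indexes `p` from `0`). -/
def mseq (p : ℕ → ℕ) (k : ℕ) : ℕ := ∏ i ∈ Finset.range k, p i

/-- `pdigit p x j` is the `(j+1)`-st digit `x_{j+1}` of the `P`-adic expansion
`x = ∑_t x_t/m_t`, `0 ≤ x_t ≤ p_t - 1` (for `P`-rational points this floor-based digit
extraction yields exactly the finite expansion, as chosen in the paper). -/
def pdigit (p : ℕ → ℕ) (x : ℝ) (j : ℕ) : ℕ :=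
  (⌊x * (mseq p (j + 1) : ℝ)⌋ % (p j : ℤ)).toNat

/-- `e^{2πit}`. -/
def eTwoPi (t : ℝ) : ℂ := Complex.exp (2 * (Real.pi : ℂ) * Complex.I * (t : ℂ))

/-- The Price function `ψ_k(x) = exp(2πi ∑_j α_j x_j / p_j)`, where
`k = ∑_j α_j m_{j-1}` with digits `0 ≤ α_j ≤ p_j - 1` (so `α_{j+1} = (k / m_j) mod p_{j+1}`
in Lean's `0`-based indexing; digits with index `> k` vanish, so the cut-off below is
harmless). -/
def price (p : ℕ → ℕ) (k : ℕ) (x : ℝ) : ℂ :=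
  eTwoPi (∑ j ∈ Finset.range (k + 1),
    (((k / mseq p j) % p j : ℕ) : ℝ) * (pdigit p x j : ℝ) / (p j : ℝ))

/-- The rank of the generalized Haar function `χ_n`, i.e. the unique `k` with
`m_k ≤ n < m_{k+1}` (and `0` for `n = 0`). -/
def hrank (p : ℕ → ℕ) (n : ℕ) : ℕ := Nat.findGreatest (fun k => mseq p k ≤ n) n

/-- The generalized Haar function `χ_n`: `χ_0 ≡ 1`, and for
`n = m_k + r(p_{k+1} - 1) + s - 1` with `0 ≤ r ≤ m_k - 1`, `1 ≤ s ≤ p_{k+1} - 1`,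
`χ_n(x) = √(m_k) · e^{2πi x_{k+1} s / p_{k+1}}` for `x ∈ [r/m_k, (r+1)/m_k)` and `0`
otherwise. -/
def ghaar (p : ℕ → ℕ) (n : ℕ) (x : ℝ) : ℂ :=
  if n = 0 then 1
  else
    let k := hrank p n
    let r := (n - mseq p k) / (p k - 1)
    let s := (n - mseq p k) % (p k - 1) + 1
    if (r : ℝ) / (mseq p k : ℝ) ≤ x ∧ x < ((r : ℝ) + 1) / (mseq p k : ℝ) then
      (Real.sqrt (mseq p k) : ℂ) * eTwoPi ((pdigit p x k : ℝ) * (s : ℝ) / (p k : ℝ))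
    else 0

/-- The multiple generalized Haar function `χ^𝒫_n(x) = χ¹_{n₁}(x₁) ⋯ χᵈ_{n_d}(x_d)`. -/
def ghaarD {d : ℕ} (p : Fin d → ℕ → ℕ) (n : Fin d → ℕ) (x : Fin d → ℝ) : ℂ :=
  ∏ j, ghaar (p j) (n j) (x j)

/-- The multiple Price function `ψ^𝒫_n(x) = ψ¹_{n₁}(x₁) ⋯ ψᵈ_{n_d}(x_d)`. -/
def priceD {d : ℕ} (p : Fin d → ℕ → ℕ) (n : Fin d → ℕ) (x : Fin d → ℝ) : ℂ :=
  ∏ j, price (p j) (n j) (x j)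

/-- The `𝒫`-adic partial sum `∑_{n̄ < Ñ} a_{n̄} χ^𝒫_{n̄}(x)`, `Ñ = (N,…,N)`, where
`n̄ < Ñ` means `n_j < mʲ_N` for all `j`. -/
def ghaarSum {d : ℕ} (p : Fin d → ℕ → ℕ) (a : (Fin d → ℕ) → ℂ) (N : ℕ)
    (x : Fin d → ℝ) : ℂ :=
  ∑ n ∈ Fintype.piFinset (fun j => Finset.range (mseq (p j) N)), a n * ghaarD p n x

/-- The `𝒫`-adic partial sum `∑_{n̄ < Ñ} b_{n̄} ψ^𝒫_{n̄}(x)`. -/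
def priceSum {d : ℕ} (p : Fin d → ℕ → ℕ) (b : (Fin d → ℕ) → ℂ) (N : ℕ)
    (x : Fin d → ℝ) : ℂ :=
  ∑ n ∈ Fintype.piFinset (fun j => Finset.range (mseq (p j) N)), b n * priceD p n x

/-- The `𝒫`-adic parallelepiped of rank `k` with corner index `n`. -/
def cell {d : ℕ} (p : Fin d → ℕ → ℕ) (k : ℕ) (n : Fin d → ℤ) : Set (Fin d → ℝ) :=
  Set.univ.pi fun j =>
    Set.Icc ((n j : ℝ) / (mseq (p j) k : ℝ)) (((n j : ℝ) + 1) / (mseq (p j) k : ℝ))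

/-- `Λᵈ`, the collection of all `𝒫`-adic parallelepipeds. -/
def Lambda {d : ℕ} (p : Fin d → ℕ → ℕ) : Set (Set (Fin d → ℝ)) :=
  {I | ∃ k n, I = cell p k n}

/-- `Ψ` is additive on the `𝒫`-adic parallelepipeds. -/
def IsAdditive {d : ℕ} (p : Fin d → ℕ → ℕ) (Ψ : Set (Fin d → ℝ) → ℂ) : Prop :=
  ∀ (I : Set (Fin d → ℝ)) (s : ℕ) (J : Fin s → Set (Fin d → ℝ)),
    I ∈ Lambda p → (∀ i, J i ∈ Lambda p) →
    (∀ i j, i ≠ j → Disjoint (interior (J i)) (interior (J j))) →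
    (⋃ i, J i) = I → Ψ I = ∑ i, Ψ (J i)

/-- Truncation of `f` by the function `lam`: `[f(x)]_{lam(x)}`. -/
def trunc {α : Type*} (f : α → ℂ) (lam : α → ℝ) (x : α) : ℂ :=
  if ‖f x‖ ≤ lam x then f x else 0

/-- Conditions (h1)–(h3) on the sequence of functions `h m : I₀ → ℝ`. -/
def HConds {d : ℕ} (p : Fin d → ℕ → ℕ) (I0 : Set (Fin d → ℝ))
    (h : ℕ → (Fin d → ℝ) → ℝ) : Prop :=
  (∀ x ∈ I0, (∀ m, 0 ≤ h m x) ∧ (Monotone fun m => h m x) ∧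
      Tendsto (fun m => h m x) atTop atTop) ∧
  ∃ C > (0 : ℝ), ∃ ε > (0 : ℝ), ∀ m : ℕ, ∃ (s : ℕ) (J : Fin s → Set (Fin d → ℝ)),
    (∀ i, J i ∈ Lambda p) ∧
    (∀ i j, i ≠ j → Disjoint (interior (J i)) (interior (J j))) ∧
    (⋃ i, J i) = I0 ∧
    (∀ i, ∀ x ∈ J i, ∀ y ∈ J i, h m x ≤ C * h m y) ∧
    (∀ i, ε ≤ ∫ x in J i, h m x)

/-- `‖χ^𝒫_{n̄}‖_∞ = ∏_j √(mʲ_{rank(n_j)})`, the sup-norm of the multiple generalized Haar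
function `χ^𝒫_{n̄}`. -/
def ghaarNormD {d : ℕ} (p : Fin d → ℕ → ℕ) (n : Fin d → ℕ) : ℝ :=
  ∏ j, Real.sqrt (mseq (p j) (hrank (p j) (n j)))

/-- The half-open `P`-adic interval `[r/m_k, (r+1)/m_k)`. -/
def hcell (p : ℕ → ℕ) (k : ℕ) (r : ℤ) : Set ℝ := {x | ⌊x * (mseq p k : ℝ)⌋ = r}

section OneDim

variable {p : ℕ → ℕ}

lemma mseq_succ (p : ℕ → ℕ) (k : ℕ) : mseq p (k + 1) = mseq p k * p k :=
  Finset.prod_range_succ _ _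

lemma mseq_pos (hp : ∀ i, 2 ≤ p i) (k : ℕ) : 0 < mseq p k :=
  Finset.prod_pos fun i _ => by have := hp i; omega

lemma mseq_mono (hp : ∀ i, 2 ≤ p i) : Monotone (mseq p) :=
  monotone_nat_of_le_succ fun k => by
    rw [mseq_succ]
    exact Nat.le_mul_of_pos_right _ (by have := hp k; omega)

lemma lt_mseq (hp : ∀ i, 2 ≤ p i) (k : ℕ) : k < mseq p k := by
  induction k with
  | zero => exact mseq_pos hp 0
  | succ k ih =>
    rw [mseq_succ]
    have := Nat.mul_le_mul_left (mseq p k) (hp k)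
    omega

lemma hrank_spec (hp : ∀ i, 2 ≤ p i) {n : ℕ} (hn : n ≠ 0) :
    mseq p (hrank p n) ≤ n ∧ n < mseq p (hrank p n + 1) := by
  refine ⟨Nat.findGreatest_spec (P := fun k => mseq p k ≤ n) (Nat.zero_le n) ?_, ?_⟩
  · simp [mseq]; omega
  · by_contra! hle
    have h1 := (lt_mseq hp (hrank p n + 1)).le.trans hle
    have h2 : hrank p n + 1 ≤ hrank p n :=
      Nat.le_findGreatest (P := fun k => mseq p k ≤ n) h1 hle
    omega

lemma hrank_lt_of_lt_mseq (hp : ∀ i, 2 ≤ p i) {n N : ℕ} (hn : n ≠ 0) (h : n < mseq p N) :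
    hrank p n < N := by
  by_contra! hle
  exact absurd ((mseq_mono hp hle).trans (hrank_spec hp hn).1) (not_le.mpr h)

lemma le_hrank_of_mseq_le (hp : ∀ i, 2 ≤ p i) {n i : ℕ} (hn : n ≠ 0) (h : mseq p i ≤ n) :
    i ≤ hrank p n := by
  by_contra! hlt
  exact absurd ((mseq_mono hp hlt).trans h) (not_le.mpr (hrank_spec hp hn).2)

lemma mem_hcell_iff (hp : ∀ i, 2 ≤ p i) {k : ℕ} {r : ℤ} {x : ℝ} :
    x ∈ hcell p k r ↔ (r : ℝ) / mseq p k ≤ x ∧ x < (r + 1) / mseq p k := by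
  have hm : (0 : ℝ) < mseq p k := by exact_mod_cast mseq_pos hp k
  rw [hcell, Set.mem_ofPred_eq, Int.floor_eq_iff, div_le_iff₀ hm, lt_div_iff₀ hm]

lemma hcell_eq_Ico (hp : ∀ i, 2 ≤ p i) (k : ℕ) (r : ℤ) :
    hcell p k r = Set.Ico ((r : ℝ) / mseq p k) ((r + 1) / mseq p k) :=
  Set.ext fun _ => mem_hcell_iff hp

lemma measurableSet_hcell (p : ℕ → ℕ) (k : ℕ) (r : ℤ) : MeasurableSet (hcell p k r) :=
  measurableSet_eq_fun (by fun_prop) measurable_const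

lemma volume_hcell (hp : ∀ i, 2 ≤ p i) (k : ℕ) (r : ℤ) :
    volume (hcell p k r) = ENNReal.ofReal (1 / mseq p k) := by
  rw [hcell_eq_Ico hp, Real.volume_Ico]
  congr 1
  ring

lemma volume_real_hcell (hp : ∀ i, 2 ≤ p i) (k : ℕ) (r : ℤ) :
    volume.real (hcell p k r) = 1 / mseq p k := by
  rw [measureReal_def, volume_hcell hp, ENNReal.toReal_ofReal (by positivity)]

lemma floor_mul_mseq (hp : ∀ i, 2 ≤ p i) (x : ℝ) (k : ℕ) :
    ⌊x * (mseq p k : ℝ)⌋ = ⌊x * (mseq p (k + 1) : ℝ)⌋ / (p k : ℤ) := by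
  have h0 : (p k : ℝ) ≠ 0 := by have := hp k; positivity
  rw [← Int.floor_div_natCast, mseq_succ]
  congr 1
  push_cast
  field_simp

lemma floor_mul_mseq_congr (hp : ∀ i, 2 ≤ p i) {x y : ℝ} {i k : ℕ} (hik : i ≤ k)
    (h : ⌊x * (mseq p k : ℝ)⌋ = ⌊y * (mseq p k : ℝ)⌋) :
    ⌊x * (mseq p i : ℝ)⌋ = ⌊y * (mseq p i : ℝ)⌋ := by
  induction k, hik using Nat.le_induction with
  | base => exact h
  | succ k _ ih => exact ih (by rw [floor_mul_mseq hp x, floor_mul_mseq hp y, h])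

lemma hcell_eq_iUnion (hp : ∀ i, 2 ≤ p i) (k : ℕ) (r : ℤ) :
    hcell p k r = ⋃ t ∈ Finset.range (p k), hcell p (k + 1) (r * p k + t) := by
  ext x
  have h0 : (0 : ℤ) < p k := by have := hp k; omega
  simp only [hcell, Set.mem_ofPred_eq, Set.mem_iUnion, Finset.mem_range, exists_prop]
  rw [floor_mul_mseq hp x k]
  constructor
  · intro h
    refine ⟨(⌊x * (mseq p (k + 1) : ℝ)⌋ % (p k : ℤ)).toNat, ?_, ?_⟩
    · have := Int.emod_lt_of_pos ⌊x * (mseq p (k + 1) : ℝ)⌋ h0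
      have := Int.emod_nonneg ⌊x * (mseq p (k + 1) : ℝ)⌋ h0.ne'
      omega
    · rw [Int.toNat_of_nonneg (Int.emod_nonneg _ h0.ne'), ← h]
      exact (Int.ediv_mul_add_emod _ _).symm
  · rintro ⟨t, ht, h⟩
    rw [h, add_comm, Int.add_mul_ediv_right _ _ h0.ne', Int.ediv_eq_zero_of_lt (by omega) (by omega),
      zero_add]

lemma pdigit_of_mem_hcell {k : ℕ} {r : ℤ} {t : ℕ} (ht : t < p k) {x : ℝ}
    (hx : x ∈ hcell p (k + 1) (r * p k + t)) : pdigit p x k = t := by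
  rw [pdigit, show ⌊x * (mseq p (k + 1) : ℝ)⌋ = _ from hx, add_comm, Int.add_mul_emod_self_right,
    Int.emod_eq_of_lt (by omega) (by omega), Int.toNat_natCast]

lemma setIntegral_hcell_eq_sum (hp : ∀ i, 2 ≤ p i) (k : ℕ) (r : ℤ) {g : ℝ → ℂ}
    (hg : ∀ t < p k, IntegrableOn g (hcell p (k + 1) (r * p k + t))) :
    ∫ x in hcell p k r, g x =
      ∑ t ∈ Finset.range (p k), ∫ x in hcell p (k + 1) (r * p k + t), g x := by
  rw [hcell_eq_iUnion hp, integral_biUnion_finset]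
  · exact fun t _ => measurableSet_hcell _ _ _
  · intro s _ t _ hst
    refine Set.disjoint_left.mpr fun x hs ht => hst ?_
    have := (show ⌊x * (mseq p (k + 1) : ℝ)⌋ = _ from hs).symm.trans ht
    omega
  · exact fun t ht => hg t (Finset.mem_range.mp ht)

lemma norm_eTwoPi (t : ℝ) : ‖eTwoPi t‖ = 1 := by
  rw [eTwoPi, show (2 * (Real.pi : ℂ) * Complex.I * (t : ℂ)) = ((2 * Real.pi * t : ℝ) : ℂ) * Complex.I
    by push_cast; ring]
  exact Complex.norm_exp_ofReal_mul_I _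

lemma eTwoPi_mul_conj (s t : ℝ) : eTwoPi s * (starRingEnd ℂ) (eTwoPi t) = eTwoPi (s - t) := by
  simp only [eTwoPi, ← Complex.exp_conj, ← Complex.exp_add]
  congr 1
  simp only [map_mul, Complex.conj_I, Complex.conj_ofReal, map_ofNat, Complex.ofReal_sub]
  ring

lemma sum_eTwoPi {q : ℕ} (hq : q ≠ 0) (s : ℤ) :
    ∑ t ∈ Finset.range q, eTwoPi ((t : ℝ) * s / q) = if (q : ℤ) ∣ s then (q : ℂ) else 0 := by
  have hprim := Complex.isPrimitiveRoot_exp q hq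
  set ζ := Complex.exp (2 * Real.pi * Complex.I / q)
  have hterm : ∀ t : ℕ, eTwoPi ((t : ℝ) * s / q) = (ζ ^ s) ^ t := by
    intro t
    rw [← Complex.exp_int_mul, ← Complex.exp_nat_mul, eTwoPi]
    congr 1
    push_cast
    ring
  simp only [hterm]
  split_ifs with hs
  · simp [(hprim.zpow_eq_one_iff_dvd s).mpr hs]
  · have h1 : ζ ^ s ≠ 1 := fun h => hs ((hprim.zpow_eq_one_iff_dvd s).mp h)
    have h2 := mul_neg_geom_sum (ζ ^ s) q
    have h3 : (ζ ^ s) ^ q = 1 := by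
      rw [← zpow_natCast, ← zpow_mul, mul_comm, zpow_mul, zpow_natCast, hprim.pow_eq_one, one_zpow]
    rw [h3, sub_self] at h2
    exact (mul_eq_zero.mp h2).resolve_left (sub_ne_zero.mpr h1.symm)

lemma setIntegral_eTwoPi_pdigit (hp : ∀ i, 2 ≤ p i) (k : ℕ) (r s : ℤ) :
    ∫ x in hcell p k r, eTwoPi ((pdigit p x k : ℝ) * s / p k) =
      if (p k : ℤ) ∣ s then 1 / (mseq p k : ℂ) else 0 := by
  have hpk : p k ≠ 0 := by have := hp k; omega
  have hm : (mseq p k : ℂ) ≠ 0 := by exact_mod_cast (mseq_pos hp k).ne'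
  have hcongr : ∀ t < p k, Set.EqOn (fun x => eTwoPi ((pdigit p x k : ℝ) * s / p k))
      (fun _ => eTwoPi ((t : ℝ) * s / p k)) (hcell p (k + 1) (r * p k + t)) := fun t ht x hx => by
    simp only [pdigit_of_mem_hcell ht hx]
  rw [setIntegral_hcell_eq_sum hp]
  · rw [Finset.sum_congr rfl fun t ht => setIntegral_congr_fun (measurableSet_hcell _ _ _)
      (hcongr t (Finset.mem_range.mp ht))]
    simp only [setIntegral_const, volume_real_hcell hp]
    rw [← Finset.smul_sum, sum_eTwoPi hpk, mseq_succ]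
    split_ifs
    · rw [Complex.real_smul]
      push_cast
      field_simp
    · simp
  · intro t ht
    refine IntegrableOn.congr_fun (integrableOn_const ?_) (hcongr t ht).symm
      (measurableSet_hcell _ _ _)
    simp [volume_hcell hp]

/-- The index `r` of the support `[r/m_k, (r+1)/m_k)` of `χ_n`. -/
def hpos (p : ℕ → ℕ) (n : ℕ) : ℕ := (n - mseq p (hrank p n)) / (p (hrank p n) - 1)

/-- The frequency `s` of `χ_n`. -/
def hfreq (p : ℕ → ℕ) (n : ℕ) : ℕ := (n - mseq p (hrank p n)) % (p (hrank p n) - 1) + 1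

lemma hfreq_lt (hp : ∀ i, 2 ≤ p i) (n : ℕ) : hfreq p n < p (hrank p n) := by
  have h2 := hp (hrank p n)
  have := Nat.mod_lt (n - mseq p (hrank p n)) (show 0 < p (hrank p n) - 1 by omega)
  rw [hfreq]
  omega

lemma eq_of_hrank_hpos_hfreq (hp : ∀ i, 2 ≤ p i) {n n' : ℕ} (hn : n ≠ 0) (hn' : n' ≠ 0)
    (hk : hrank p n = hrank p n') (hr : hpos p n = hpos p n') (hs : hfreq p n = hfreq p n') :
    n = n' := by
  have h1 := (hrank_spec hp hn).1
  have h2 := (hrank_spec hp hn').1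
  simp only [hpos, hfreq, hk] at hr hs h1
  have e1 := Nat.div_add_mod (n - mseq p (hrank p n')) (p (hrank p n') - 1)
  have e2 := Nat.div_add_mod (n' - mseq p (hrank p n')) (p (hrank p n') - 1)
  rw [hr, Nat.add_right_cancel hs] at e1
  omega

open Classical in
lemma ghaar_of_ne_zero (hp : ∀ i, 2 ≤ p i) {n : ℕ} (hn : n ≠ 0) (x : ℝ) :
    ghaar p n x = if x ∈ hcell p (hrank p n) (hpos p n) then
      (Real.sqrt (mseq p (hrank p n)) : ℂ) *
        eTwoPi ((pdigit p x (hrank p n) : ℝ) * (hfreq p n : ℝ) / (p (hrank p n) : ℝ)) else 0 := by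
  simp only [ghaar, if_neg hn, mem_hcell_iff hp, hpos, hfreq, Int.cast_natCast]

lemma hrank_zero (p : ℕ → ℕ) : hrank p 0 = 0 := rfl

lemma norm_ghaar_le (hp : ∀ i, 2 ≤ p i) (n : ℕ) (x : ℝ) :
    ‖ghaar p n x‖ ≤ Real.sqrt (mseq p (hrank p n)) := by
  rcases eq_or_ne n 0 with rfl | hn
  · simp [ghaar, hrank_zero, mseq]
  · rw [ghaar_of_ne_zero hp hn]
    split_ifs
    · simp [norm_eTwoPi, abs_of_nonneg]
    · simp

lemma measurable_ghaar (hp : ∀ i, 2 ≤ p i) (n : ℕ) : Measurable (ghaar p n) := by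
  classical
  rcases eq_or_ne n 0 with rfl | hn
  · rw [show ghaar p 0 = fun _ => 1 from funext fun x => if_pos rfl]
    exact measurable_const
  · rw [funext (ghaar_of_ne_zero hp hn)]
    refine Measurable.ite (measurableSet_hcell _ _ _) (measurable_const.mul ?_) measurable_const
    have hd : Measurable fun x => pdigit p x (hrank p n) :=
      (measurable_of_countable fun z : ℤ => (z % (p (hrank p n) : ℤ)).toNat).comp
        (Int.measurable_floor.comp (measurable_id.mul_const _))
    exact (measurable_of_countable fun z : ℕ =>
      eTwoPi ((z : ℝ) * (hfreq p n : ℝ) / (p (hrank p n) : ℝ))).comp hd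

lemma ghaar_congr (hp : ∀ i, 2 ≤ p i) {n N : ℕ} (hn : n < mseq p N) {x y : ℝ}
    (hxy : ⌊x * (mseq p N : ℝ)⌋ = ⌊y * (mseq p N : ℝ)⌋) : ghaar p n x = ghaar p n y := by
  rcases eq_or_ne n 0 with rfl | h0
  · simp [ghaar]
  · have hk := hrank_lt_of_lt_mseq hp h0 hn
    simp only [ghaar_of_ne_zero hp h0, hcell, Set.mem_ofPred_eq, pdigit,
      floor_mul_mseq_congr hp hk.le hxy, floor_mul_mseq_congr hp (i := hrank p n + 1) hk hxy]
    congr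

/-- The intersection of a cell with the support of a Haar function of at least the same rank. -/
lemma hcell_inter_hcell (hp : ∀ i, 2 ≤ p i) {i k : ℕ} (hik : i ≤ k) (c r : ℤ) :
    hcell p i c ∩ hcell p k r = hcell p k r ∨ hcell p i c ∩ hcell p k r = ∅ := by
  rcases (hcell p i c ∩ hcell p k r).eq_empty_or_nonempty with h | ⟨y, hy, hyk⟩
  · exact Or.inr h
  · refine Or.inl (Set.inter_eq_right.mpr fun x hx => ?_)
    exact (floor_mul_mseq_congr hp hik (hx.trans hyk.symm)).trans hy

lemma setIntegral_ghaar_mul_eq_zero (hp : ∀ i, 2 ≤ p i) {n i : ℕ} (hn : n ≠ 0)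
    (hi : i ≤ hrank p n) (c : ℤ) {g : ℝ → ℂ}
    (hg : ∀ x ∈ hcell p (hrank p n) (hpos p n), ∀ y ∈ hcell p (hrank p n) (hpos p n), g x = g y) :
    ∫ x in hcell p i c, ghaar p n x * g x = 0 := by
  classical
  set S := hcell p (hrank p n) (hpos p n) with hS
  have hind : (fun x => ghaar p n x * g x) = S.indicator fun x => ghaar p n x * g x := by
    ext x
    by_cases hx : x ∈ S
    · rw [Set.indicator_of_mem hx]
    · rw [Set.indicator_of_notMem hx, ghaar_of_ne_zero hp hn, if_neg hx, zero_mul]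
  rw [hind, setIntegral_indicator (measurableSet_hcell _ _ _)]
  rcases hcell_inter_hcell hp hi c (hpos p n) with h | h
  · rw [h]
    obtain ⟨z, hz⟩ : ∃ z, ∀ x ∈ S, g x = z := by
      rcases S.eq_empty_or_nonempty with h | ⟨y, hy⟩
      · exact ⟨0, by simp [h]⟩
      · exact ⟨g y, fun x hx => hg x hx y hy⟩
    have : ∀ x ∈ S, ghaar p n x * g x = (Real.sqrt (mseq p (hrank p n)) : ℂ) * z *
        eTwoPi ((pdigit p x (hrank p n) : ℝ) * ((hfreq p n : ℤ) : ℝ) / (p (hrank p n) : ℝ)) := by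
      intro x hx
      rw [hz x hx, ghaar_of_ne_zero hp hn, if_pos hx, Int.cast_natCast]
      ring
    rw [setIntegral_congr_fun (measurableSet_hcell _ _ _) this, integral_const_mul,
      setIntegral_eTwoPi_pdigit hp, if_neg, mul_zero]
    intro hdvd
    have := Nat.le_of_dvd (Nat.succ_pos _) (Int.natCast_dvd_natCast.mp hdvd)
    exact absurd (hfreq_lt hp n) (not_lt.mpr this)
  · rw [h, setIntegral_empty]

lemma setIntegral_ghaar_eq_zero (hp : ∀ i, 2 ≤ p i) {n i : ℕ} (hi : mseq p i ≤ n) (c : ℤ) :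
    ∫ x in hcell p i c, ghaar p n x = 0 := by
  have hn : n ≠ 0 := ((mseq_pos hp i).trans_le hi).ne'
  simpa using setIntegral_ghaar_mul_eq_zero hp hn (le_hrank_of_mseq_le hp hn hi) c
    (g := fun _ => 1) fun _ _ _ _ => rfl

lemma setIntegral_ghaar_mul_conj_of_lt_mseq (hp : ∀ i, 2 ≤ p i) {n n' : ℕ} (hn' : n' ≠ 0)
    (hn : n < mseq p (hrank p n')) :
    ∫ x in hcell p 0 0, ghaar p n' x * (starRingEnd ℂ) (ghaar p n x) = 0 :=
  setIntegral_ghaar_mul_eq_zero hp hn' (Nat.zero_le _) 0 fun x hx y hy => by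
    rw [ghaar_congr hp hn (hx.trans hy.symm)]

lemma setIntegral_ghaar_mul_conj_symm (p : ℕ → ℕ) (n n' : ℕ) (s : Set ℝ) :
    ∫ x in s, ghaar p n' x * (starRingEnd ℂ) (ghaar p n x) =
      (starRingEnd ℂ) (∫ x in s, ghaar p n x * (starRingEnd ℂ) (ghaar p n' x)) := by
  rw [← integral_conj]
  simp [mul_comm]

lemma hpos_lt (hp : ∀ i, 2 ≤ p i) {n : ℕ} (hn : n ≠ 0) : hpos p n < mseq p (hrank p n) := by
  obtain ⟨h1, h2⟩ := hrank_spec hp hn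
  have h3 := hp (hrank p n)
  rw [hpos, Nat.div_lt_iff_lt_mul (by omega), Nat.mul_sub_one]
  rw [mseq_succ] at h2
  omega

lemma hcell_hpos_subset (hp : ∀ i, 2 ≤ p i) {n : ℕ} (hn : n ≠ 0) :
    hcell p (hrank p n) (hpos p n) ⊆ hcell p 0 0 := by
  intro x hx
  have hm : (0 : ℝ) < mseq p (hrank p n) := by exact_mod_cast mseq_pos hp _
  have h1 : (hpos p n : ℝ) + 1 ≤ mseq p (hrank p n) := by exact_mod_cast hpos_lt hp hn
  obtain ⟨h2, h3⟩ := (mem_hcell_iff hp).mp hx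
  refine (mem_hcell_iff hp).mpr ⟨?_, ?_⟩
  · refine le_trans ?_ h2
    simp only [Int.cast_zero, zero_div, Int.cast_natCast]
    positivity
  · refine h3.trans_le ?_
    rw [div_le_iff₀ hm]
    simpa [mseq] using h1

/-- The generalized Haar system is orthonormal on `[0, 1)`. -/
lemma setIntegral_ghaar_mul_conj (hp : ∀ i, 2 ≤ p i) (n n' : ℕ) :
    ∫ x in hcell p 0 0, ghaar p n' x * (starRingEnd ℂ) (ghaar p n x) =
      if n' = n then 1 else 0 := by
  classical
  rcases eq_or_ne n 0 with rfl | hn <;> rcases eq_or_ne n' 0 with rfl | hn'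
  · simp [ghaar, volume_real_hcell hp, mseq]
  · rw [if_neg hn', setIntegral_ghaar_mul_conj_of_lt_mseq hp hn' (mseq_pos hp _)]
  · rw [if_neg hn.symm, setIntegral_ghaar_mul_conj_symm,
      setIntegral_ghaar_mul_conj_of_lt_mseq hp hn (mseq_pos hp _), map_zero]
  rcases lt_trichotomy (hrank p n) (hrank p n') with hlt | heq | hlt
  · rw [if_neg (by rintro rfl; exact hlt.false), setIntegral_ghaar_mul_conj_of_lt_mseq hp hn'
      ((hrank_spec hp hn).2.trans_le (mseq_mono hp hlt))]
  · by_cases hr : hpos p n = hpos p n'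
    · set S := hcell p (hrank p n) (hpos p n) with hS
      set k := hrank p n with hk
      have hm : (mseq p k : ℂ) ≠ 0 := by exact_mod_cast (mseq_pos hp k).ne'
      have hind : (fun x => ghaar p n' x * (starRingEnd ℂ) (ghaar p n x)) =
          S.indicator fun x => (mseq p k : ℂ) *
            eTwoPi ((pdigit p x k : ℝ) * (((hfreq p n' : ℤ) - hfreq p n : ℤ) : ℝ) / p k) := by
        ext x
        rw [ghaar_of_ne_zero hp hn, ghaar_of_ne_zero hp hn', ← heq, ← hr]
        by_cases hx : x ∈ S
        · rw [Set.indicator_of_mem hx, if_pos hx, if_pos hx, map_mul, mul_mul_mul_comm,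
            eTwoPi_mul_conj, Complex.conj_ofReal, ← Complex.ofReal_mul,
            Real.mul_self_sqrt (Nat.cast_nonneg _), Complex.ofReal_natCast]
          congr 2
          push_cast
          ring
        · rw [Set.indicator_of_notMem hx, if_neg hx, zero_mul]
      rw [hind, setIntegral_indicator (measurableSet_hcell _ _ _),
        Set.inter_eq_right.mpr (hcell_hpos_subset hp hn), integral_const_mul,
        setIntegral_eTwoPi_pdigit hp]
      by_cases hs : hfreq p n' = hfreq p n
      · rw [if_pos (by simp [hs]), if_pos (eq_of_hrank_hpos_hfreq hp hn' hn heq.symm hr.symm hs),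
          mul_one_div_cancel hm]
      · rw [if_neg, if_neg (by rintro rfl; exact hs rfl), mul_zero]
        intro hdvd
        have h1 : hfreq p n < p k := hfreq_lt hp n
        have h2 : hfreq p n' < p k := heq ▸ hfreq_lt hp n'
        have hpk : p k = p (hrank p n) := rfl
        have h3 := Int.eq_zero_of_abs_lt_dvd hdvd (by rw [abs_lt]; omega)
        omega
    · rw [if_neg (by rintro rfl; exact hr rfl)]
      refine (integral_congr_ae (Eventually.of_forall fun x => ?_)).trans (integral_zero _ _)
      rw [ghaar_of_ne_zero hp hn, ghaar_of_ne_zero hp hn', ← heq]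
      split_ifs with h1 h2
      · exact absurd (by exact_mod_cast h2.symm.trans h1) hr
      all_goals simp
  · rw [if_neg (by rintro rfl; exact hlt.false), setIntegral_ghaar_mul_conj_symm,
      setIntegral_ghaar_mul_conj_of_lt_mseq hp hn
        ((hrank_spec hp hn').2.trans_le (mseq_mono hp hlt)), map_zero]

end OneDim

/-- The half-open `𝒫`-adic parallelepiped of rank `k` with corner index `c`. -/
def hcellD {d : ℕ} (p : Fin d → ℕ → ℕ) (k : ℕ) (c : Fin d → ℤ) : Set (Fin d → ℝ) :=
  Set.univ.pi fun j => hcell (p j) k (c j)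

/-- The volume of the `𝒫`-adic parallelepipeds of rank `k`. -/
def vcell {d : ℕ} (p : Fin d → ℕ → ℕ) (k : ℕ) : ℝ := ∏ j, 1 / (mseq (p j) k : ℝ)

section MultiDim

variable {d : ℕ} {p : Fin d → ℕ → ℕ}

lemma mem_hcellD {k : ℕ} {c : Fin d → ℤ} {x : Fin d → ℝ} :
    x ∈ hcellD p k c ↔ ∀ j, ⌊x j * (mseq (p j) k : ℝ)⌋ = c j := by
  simp [hcellD, hcell]

lemma measurableSet_hcellD (p : Fin d → ℕ → ℕ) (k : ℕ) (c : Fin d → ℤ) :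
    MeasurableSet (hcellD p k c) :=
  MeasurableSet.univ_pi fun _ => measurableSet_hcell _ _ _

lemma volume_hcellD (hp : ∀ j i, 2 ≤ p j i) (k : ℕ) (c : Fin d → ℤ) :
    volume (hcellD p k c) = ENNReal.ofReal (vcell p k) := by
  rw [hcellD, volume_pi, Measure.pi_pi, vcell, ENNReal.ofReal_prod_of_nonneg
    fun j _ => by positivity]
  exact Finset.prod_congr rfl fun j _ => volume_hcell (hp j) _ _

lemma vcell_pos (hp : ∀ j i, 2 ≤ p j i) (k : ℕ) : 0 < vcell p k :=
  Finset.prod_pos fun j _ => one_div_pos.mpr (by exact_mod_cast mseq_pos (hp j) k)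

lemma vcell_le_one (hp : ∀ j i, 2 ≤ p j i) (k : ℕ) : vcell p k ≤ 1 :=
  Finset.prod_le_one (fun _ _ => by positivity) fun j _ => by
    have h : (1 : ℝ) ≤ mseq (p j) k := by exact_mod_cast mseq_pos (hp j) k
    exact (div_le_one (by linarith)).mpr h

lemma volume_real_hcellD (hp : ∀ j i, 2 ≤ p j i) (k : ℕ) (c : Fin d → ℤ) :
    volume.real (hcellD p k c) = vcell p k := by
  rw [measureReal_def, volume_hcellD hp, ENNReal.toReal_ofReal (vcell_pos hp k).le]

lemma volume_hcellD_lt_top (hp : ∀ j i, 2 ≤ p j i) (k : ℕ) (c : Fin d → ℤ) :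
    volume (hcellD p k c) < ⊤ := by
  rw [volume_hcellD hp]
  exact ENNReal.ofReal_lt_top

lemma vcell_le_vcell_succ (hp : ∀ j i, 2 ≤ p j i) {M : ℕ} (hM : ∀ j i, p j i ≤ M) (k : ℕ) :
    vcell p k ≤ M ^ d * vcell p (k + 1) := by
  have hMd : (M : ℝ) ^ d = ∏ _j : Fin d, (M : ℝ) := by simp
  rw [vcell, vcell, hMd, ← Finset.prod_mul_distrib]
  refine Finset.prod_le_prod (fun _ _ => by positivity) fun j _ => ?_
  have h1 : (0 : ℝ) < mseq (p j) k := by exact_mod_cast mseq_pos (hp j) k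
  have h2 : (0 : ℝ) < p j k := by exact_mod_cast (zero_lt_two.trans_le (hp j k))
  have h3 : (p j k : ℝ) ≤ M := by exact_mod_cast hM j k
  rw [mseq_succ, Nat.cast_mul, mul_one_div, div_le_div_iff₀ h1 (by positivity), one_mul, mul_comm]
  gcongr

/-- The corner indices of the subcells of rank `k + 1` of `hcellD p k c`. -/
def hchild (p : Fin d → ℕ → ℕ) (k : ℕ) (c : Fin d → ℤ) (t : Fin d → ℕ) : Fin d → ℤ :=
  fun j => c j * p j k + t j

lemma hcellD_eq_iUnion (hp : ∀ j i, 2 ≤ p j i) (k : ℕ) (c : Fin d → ℤ) :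
    hcellD p k c = ⋃ t ∈ Fintype.piFinset (fun j => Finset.range (p j k)),
      hcellD p (k + 1) (hchild p k c t) := by
  ext x
  simp only [hcellD, Set.mem_univ_pi, hcell_eq_iUnion (hp _) k, Set.mem_iUnion, exists_prop,
    Fintype.mem_piFinset, hchild]
  constructor
  · intro h
    choose t ht hx using h
    exact ⟨t, ht, hx⟩
  · rintro ⟨t, ht, hx⟩ j
    exact ⟨t j, ht j, hx j⟩

lemma setIntegral_hcellD_inter_eq_sum (hp : ∀ j i, 2 ≤ p j i) (k : ℕ) (c : Fin d → ℤ)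
    {E : Set (Fin d → ℝ)} (hE : MeasurableSet E) {F : Type*} [NormedAddCommGroup F]
    [NormedSpace ℝ F] {g : (Fin d → ℝ) → F} (hg : IntegrableOn g (hcellD p k c)) :
    ∫ x in hcellD p k c ∩ E, g x =
      ∑ t ∈ Fintype.piFinset (fun j => Finset.range (p j k)),
        ∫ x in hcellD p (k + 1) (hchild p k c t) ∩ E, g x := by
  have hun := hcellD_eq_iUnion hp k c
  rw [hun, Set.iUnion₂_inter, integral_biUnion_finset]
  · exact fun t _ => (measurableSet_hcellD _ _ _).inter hE
  · intro s _ t _ hst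
    refine Set.disjoint_left.mpr fun x hs ht => hst (funext fun j => ?_)
    have := (mem_hcellD.mp hs.1 j).symm.trans (mem_hcellD.mp ht.1 j)
    simpa [hchild] using this
  · refine fun t ht => hg.mono_set (Set.inter_subset_left.trans ?_)
    rw [hun]
    exact Set.subset_biUnion_of_mem (u := fun t => hcellD p (k + 1) (hchild p k c t)) ht

lemma hcellD_hchild_subset (hp : ∀ j i, 2 ≤ p j i) (k : ℕ) (c : Fin d → ℤ) {t : Fin d → ℕ}
    (ht : t ∈ Fintype.piFinset (fun j => Finset.range (p j k))) :
    hcellD p (k + 1) (hchild p k c t) ⊆ hcellD p k c := by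
  rw [hcellD_eq_iUnion hp k c]
  exact Set.subset_biUnion_of_mem (u := fun t => hcellD p (k + 1) (hchild p k c t)) ht

/-- Let `G` be, from rank `K` on, a martingale with respect to the `𝒫`-adic cells which is bounded
by `H` off a set `E`. On a cell where `E` has small relative measure, the integral of `G N` over `E`
is controlled by the measure of `E`, uniformly in `N`. -/
lemma norm_setIntegral_hcellD_inter_le (hp : ∀ j i, 2 ≤ p j i) {M : ℕ} (hM : ∀ j i, p j i ≤ M)
    {G : ℕ → (Fin d → ℝ) → ℂ} {K : ℕ}
    (hconst : ∀ N ≥ K, ∀ c, ∀ x ∈ hcellD p N c, ∀ y ∈ hcellD p N c, G N x = G N y)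
    (hmart : ∀ i ≥ K, ∀ N ≥ i, ∀ c, ∫ x in hcellD p i c, G N x = ∫ x in hcellD p i c, G i x)
    (hint : ∀ N i c, IntegrableOn (G N) (hcellD p i c))
    {E : Set (Fin d → ℝ)} (hE : MeasurableSet E) {H : ℝ} (hH : 0 ≤ H) (j : ℕ) :
    ∀ i c, K ≤ i + j →
      (∀ N ≥ K, ∀ x ∈ hcellD p i c \ E, ‖G N x‖ ≤ H) →
      2 * M ^ d * volume.real (hcellD p i c ∩ E) ≤ vcell p (max i K) →
      ‖∫ x in hcellD p i c ∩ E, G (i + j) x‖ ≤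
        4 * M ^ d * H * volume.real (hcellD p i c ∩ E) := by
  have hMd : (1 : ℝ) ≤ (M : ℝ) ^ d := by
    rcases d with _ | d
    · simp
    · exact one_le_pow₀ (by exact_mod_cast one_le_two.trans ((hp 0 0).trans (hM 0 0)))
  have hfin : ∀ i c (s : Set (Fin d → ℝ)), volume (hcellD p i c ∩ s) < ⊤ := fun i c s =>
    (measure_mono Set.inter_subset_left).trans_lt (volume_hcellD_lt_top hp i c)
  have hexists : ∀ i c, volume.real (hcellD p i c ∩ E) < vcell p i →
      ∃ y ∈ hcellD p i c, y ∉ E := by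
    intro i c hlt
    by_contra! hsub
    rw [Set.inter_eq_left.mpr hsub, volume_real_hcellD hp] at hlt
    exact hlt.false
  have hbound : ∀ i c, K ≤ i → (∀ N ≥ K, ∀ x ∈ hcellD p i c \ E, ‖G N x‖ ≤ H) →
      volume.real (hcellD p i c ∩ E) < vcell p i → ∀ x ∈ hcellD p i c, ‖G i x‖ ≤ H := by
    intro i c hi hb hlt x hx
    obtain ⟨y, hy, hyE⟩ := hexists i c hlt
    rw [hconst i hi c x hx y hy]
    exact hb i hi y ⟨hy, hyE⟩
  induction j with
  | zero =>
    intro i c hi hb hE'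
    rw [add_zero] at hi ⊢
    rw [max_eq_left hi] at hE'
    have hv := vcell_pos hp i
    have h0 : 0 ≤ volume.real (hcellD p i c ∩ E) := measureReal_nonneg
    have hlt : volume.real (hcellD p i c ∩ E) < vcell p i := by nlinarith
    refine (norm_setIntegral_le_of_norm_le_const (hfin i c E)
      fun x hx => hbound i c hi hb hlt x hx.1).trans ?_
    have : 0 ≤ H * volume.real (hcellD p i c ∩ E) := mul_nonneg hH h0
    nlinarith
  | succ j ih =>
    intro i c hi hb hE'
    rw [show i + (j + 1) = i + 1 + j by ring] at hi ⊢
    have hsum : volume.real (hcellD p i c ∩ E) =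
        ∑ t ∈ Fintype.piFinset (fun j => Finset.range (p j i)),
          volume.real (hcellD p (i + 1) (hchild p i c t) ∩ E) := by
      simpa using setIntegral_hcellD_inter_eq_sum hp i c hE (g := fun _ => (1 : ℝ))
        (integrableOn_const (volume_hcellD_lt_top hp i c).ne)
    rw [setIntegral_hcellD_inter_eq_sum hp i c hE (hint _ _ _), hsum, Finset.mul_sum]
    refine (norm_sum_le _ _).trans (Finset.sum_le_sum fun t ht => ?_)
    have hsub := hcellD_hchild_subset hp i c ht
    set c' := hchild p i c t
    have hb' : ∀ N ≥ K, ∀ x ∈ hcellD p (i + 1) c' \ E, ‖G N x‖ ≤ H :=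
      fun N hN x hx => hb N hN x ⟨hsub hx.1, hx.2⟩
    by_cases hsmall : 2 * M ^ d * volume.real (hcellD p (i + 1) c' ∩ E) ≤ vcell p (max (i + 1) K)
    · exact ih (i + 1) c' hi hb' hsmall
    push Not at hsmall
    have hmono : volume.real (hcellD p (i + 1) c' ∩ E) ≤ volume.real (hcellD p i c ∩ E) :=
      measureReal_mono (Set.inter_subset_inter_left _ hsub) (hfin i c E).ne
    have hKi : K ≤ i := by
      by_contra! hlt
      rw [max_eq_right hlt] at hsmall
      rw [max_eq_right hlt.le] at hE'
      have := mul_le_mul_of_nonneg_left hmono (show (0 : ℝ) ≤ 2 * M ^ d by positivity)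
      linarith
    rw [max_eq_left (by omega)] at hsmall
    rw [max_eq_left hKi] at hE'
    have hv := vcell_pos hp (i + 1)
    have hlt : volume.real (hcellD p (i + 1) c' ∩ E) < vcell p (i + 1) := by
      have := vcell_le_vcell_succ hp hM i
      have h2 : (M : ℝ) ^ d * (2 * volume.real (hcellD p i c ∩ E)) ≤ M ^ d * vcell p (i + 1) := by
        linarith
      have := le_of_mul_le_mul_left h2 (by linarith)
      linarith
    have h1 : ‖∫ x in hcellD p (i + 1) c', G (i + 1 + j) x‖ ≤ H * vcell p (i + 1) := by
      rw [hmart (i + 1) (by omega) _ (by omega), ← volume_real_hcellD hp (i + 1) c']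
      exact norm_setIntegral_le_of_norm_le_const (volume_hcellD_lt_top hp _ _)
        (hbound (i + 1) c' (by omega) hb' hlt)
    have h2 : ‖∫ x in hcellD p (i + 1) c' \ E, G (i + 1 + j) x‖ ≤ H * vcell p (i + 1) := by
      refine (norm_setIntegral_le_of_norm_le_const (hfin _ _ _)
        (hb' (i + 1 + j) hi)).trans ?_
      rw [← volume_real_hcellD hp (i + 1) c']
      exact mul_le_mul_of_nonneg_left
        (measureReal_mono Set.sdiff_subset (volume_hcellD_lt_top hp _ _).ne) hH
    have h3 := integral_inter_add_sdiff hE (hint (i + 1 + j) (i + 1) c')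
    rw [eq_sub_of_add_eq h3]
    refine (norm_sub_le _ _).trans ((add_le_add h1 h2).trans ?_)
    nlinarith [mul_le_mul_of_nonneg_left hsmall.le hH]

lemma norm_ghaarD_le (hp : ∀ j i, 2 ≤ p j i) (n : Fin d → ℕ) (x : Fin d → ℝ) :
    ‖ghaarD p n x‖ ≤ ghaarNormD p n := by
  rw [ghaarD, norm_prod]
  exact Finset.prod_le_prod (fun _ _ => norm_nonneg _) fun j _ => norm_ghaar_le (hp j) _ _

lemma measurable_ghaarD (hp : ∀ j i, 2 ≤ p j i) (n : Fin d → ℕ) : Measurable (ghaarD p n) :=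
  Finset.measurable_fun_prod _ fun j _ => (measurable_ghaar (hp j) (n j)).comp (measurable_pi_apply j)

lemma measurable_ghaarSum (hp : ∀ j i, 2 ≤ p j i) (a : (Fin d → ℕ) → ℂ) (N : ℕ) :
    Measurable (ghaarSum p a N) :=
  Finset.measurable_fun_sum _ fun n _ => (measurable_ghaarD hp n).const_mul (a n)

lemma norm_ghaarSum_le (hp : ∀ j i, 2 ≤ p j i) (a : (Fin d → ℕ) → ℂ) (N : ℕ) :
    ∃ B, ∀ x, ‖ghaarSum p a N x‖ ≤ B :=
  ⟨_, fun x => (norm_sum_le _ _).trans (Finset.sum_le_sum fun n _ =>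
    (norm_mul_le _ _).trans (mul_le_mul_of_nonneg_left (norm_ghaarD_le hp n x) (norm_nonneg _)))⟩

lemma ghaarD_congr (hp : ∀ j i, 2 ≤ p j i) {n : Fin d → ℕ} {N : ℕ}
    (hn : n ∈ Fintype.piFinset (fun j => Finset.range (mseq (p j) N))) {c : Fin d → ℤ}
    {x y : Fin d → ℝ} (hx : x ∈ hcellD p N c) (hy : y ∈ hcellD p N c) :
    ghaarD p n x = ghaarD p n y :=
  Finset.prod_congr rfl fun j _ =>
    ghaar_congr (hp j) (Finset.mem_range.mp (Fintype.mem_piFinset.mp hn j))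
      ((mem_hcellD.mp hx j).trans (mem_hcellD.mp hy j).symm)

lemma ghaarSum_congr (hp : ∀ j i, 2 ≤ p j i) (a : (Fin d → ℕ) → ℂ) {N : ℕ} {c : Fin d → ℤ}
    {x y : Fin d → ℝ} (hx : x ∈ hcellD p N c) (hy : y ∈ hcellD p N c) :
    ghaarSum p a N x = ghaarSum p a N y :=
  Finset.sum_congr rfl fun n hn => by rw [ghaarD_congr hp hn hx hy]

lemma setIntegral_hcellD_prod (p : Fin d → ℕ → ℕ) (k : ℕ) (c : Fin d → ℤ) (g : Fin d → ℝ → ℂ) :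
    ∫ x in hcellD p k c, ∏ j, g j (x j) = ∏ j, ∫ x in hcell (p j) k (c j), g j x := by
  rw [hcellD, volume_pi, Measure.restrict_pi_pi, integral_fintype_prod_eq_prod]

lemma setIntegral_ghaarD_mul_conj (hp : ∀ j i, 2 ≤ p j i) (n n' : Fin d → ℕ) :
    ∫ x in hcellD p 0 0, ghaarD p n' x * (starRingEnd ℂ) (ghaarD p n x) =
      if n' = n then 1 else 0 := by
  simp only [ghaarD, map_prod, ← Finset.prod_mul_distrib]
  rw [setIntegral_hcellD_prod p 0 0
    (fun j x => ghaar (p j) (n' j) x * (starRingEnd ℂ) (ghaar (p j) (n j) x))]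
  simp only [Pi.zero_apply, setIntegral_ghaar_mul_conj (hp _), Finset.prod_ite_zero]
  simp [funext_iff]

lemma integrableOn_hcellD_of_bounded (hp : ∀ j i, 2 ≤ p j i) {g : (Fin d → ℝ) → ℂ}
    (hg : Measurable g) {B : ℝ} (hB : ∀ x, ‖g x‖ ≤ B) (k : ℕ) (c : Fin d → ℤ) :
    IntegrableOn g (hcellD p k c) :=
  Measure.integrableOn_of_bounded (volume_hcellD_lt_top hp k c).ne hg.aestronglyMeasurable
    (Eventually.of_forall hB)

lemma piFinset_range_mseq_subset (hp : ∀ j i, 2 ≤ p j i) {i N : ℕ} (hiN : i ≤ N) :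
    Fintype.piFinset (fun j => Finset.range (mseq (p j) i)) ⊆
      Fintype.piFinset (fun j => Finset.range (mseq (p j) N)) :=
  Fintype.piFinset_subset _ _ fun j => Finset.range_subset_range.mpr (mseq_mono (hp j) hiN)

lemma setIntegral_ghaarSum (hp : ∀ j i, 2 ≤ p j i) (a : (Fin d → ℕ) → ℂ) {i N : ℕ} (hiN : i ≤ N)
    (c : Fin d → ℤ) :
    ∫ x in hcellD p i c, ghaarSum p a N x = ∫ x in hcellD p i c, ghaarSum p a i x := by
  have hint : ∀ n, IntegrableOn (fun x => a n * ghaarD p n x) (hcellD p i c) := fun n =>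
    (integrableOn_hcellD_of_bounded hp (measurable_ghaarD hp n) (norm_ghaarD_le hp n) i c).const_mul _
  simp only [ghaarSum]
  rw [integral_finsetSum _ fun n _ => hint n, integral_finsetSum _ fun n _ => hint n]
  refine (Finset.sum_subset (piFinset_range_mseq_subset hp hiN) fun n _ hn => ?_).symm
  simp only [Fintype.mem_piFinset, Finset.mem_range, not_forall, not_lt] at hn
  obtain ⟨j, hj⟩ := hn
  simp only [integral_const_mul, ghaarD]
  rw [setIntegral_hcellD_prod p i c (fun j x => ghaar (p j) (n j) x), Finset.prod_eq_zero
    (Finset.mem_univ j) (setIntegral_ghaar_eq_zero (hp j) hj _), mul_zero]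

lemma setIntegral_ghaarSum_mul_conj (hp : ∀ j i, 2 ≤ p j i) (a : (Fin d → ℕ) → ℂ) {N : ℕ}
    {n : Fin d → ℕ} (hn : n ∈ Fintype.piFinset (fun j => Finset.range (mseq (p j) N))) :
    ∫ x in hcellD p 0 0, ghaarSum p a N x * (starRingEnd ℂ) (ghaarD p n x) = a n := by
  have hint : ∀ n', IntegrableOn
      (fun x => a n' * (ghaarD p n' x * (starRingEnd ℂ) (ghaarD p n x))) (hcellD p 0 0) := by
    intro n'
    refine (integrableOn_hcellD_of_bounded hp (B := ghaarNormD p n' * ghaarNormD p n)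
      ((measurable_ghaarD hp n').mul (Complex.continuous_conj.measurable.comp
        (measurable_ghaarD hp n))) (fun x => ?_) 0 0).const_mul _
    rw [Pi.mul_apply, norm_mul, Function.comp_apply, RCLike.norm_conj]
    exact mul_le_mul (norm_ghaarD_le hp _ _) (norm_ghaarD_le hp _ _) (norm_nonneg _)
      ((norm_nonneg _).trans (norm_ghaarD_le hp n' x))
  simp only [ghaarSum, Finset.sum_mul, mul_assoc]
  rw [integral_finsetSum _ fun n' _ => hint n']
  simp only [integral_const_mul, setIntegral_ghaarD_mul_conj hp, mul_ite, mul_one, mul_zero]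
  rw [Finset.sum_ite_eq', if_pos hn]

end MultiDim

section Recovery

variable {d : ℕ} {p : Fin d → ℕ → ℕ}

lemma cell_eq_Icc (p : Fin d → ℕ → ℕ) (k : ℕ) (c : Fin d → ℤ) :
    cell p k c = Set.Icc (fun j => (c j : ℝ) / (mseq (p j) k : ℝ))
      (fun j => ((c j : ℝ) + 1) / (mseq (p j) k : ℝ)) :=
  Set.pi_univ_Icc _ _

lemma hcellD_subset_cell (hp : ∀ j i, 2 ≤ p j i) (k : ℕ) (c : Fin d → ℤ) :
    hcellD p k c ⊆ cell p k c :=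
  Set.pi_mono fun j _ => (hcell_eq_Ico (hp j) k (c j)).subset.trans Set.Ico_subset_Icc_self

lemma cell_ae_eq_hcellD (hp : ∀ j i, 2 ≤ p j i) (k : ℕ) (c : Fin d → ℤ) :
    cell p k c =ᵐ[volume] hcellD p k c := by
  simp only [cell_eq_Icc, hcellD, hcell_eq_Ico (hp _)]
  exact Measure.univ_pi_Ico_ae_eq_Icc.symm

lemma Icc_zero_one_eq_cell (p : Fin d → ℕ → ℕ) : Set.Icc (0 : Fin d → ℝ) 1 = cell p 0 0 := by
  rw [cell_eq_Icc]
  refine congrArg₂ Set.Icc ?_ ?_ <;> ext j <;> simp [mseq]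

lemma measurableSet_of_mem_Lambda {I : Set (Fin d → ℝ)} (hI : I ∈ Lambda p) :
    MeasurableSet I := by
  obtain ⟨k, c, rfl⟩ := hI
  rw [cell_eq_Icc]
  exact measurableSet_Icc

lemma aedisjoint_of_disjoint_interior {I J : Set (Fin d → ℝ)} (hI : I ∈ Lambda p)
    (hJ : J ∈ Lambda p) (h : Disjoint (interior I) (interior J)) : AEDisjoint volume I J := by
  have hnull : ∀ {I : Set (Fin d → ℝ)}, I ∈ Lambda p → volume (frontier I) = 0 := by
    rintro _ ⟨k, c, rfl⟩
    rw [cell_eq_Icc]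
    exact Convex.addHaar_frontier _ (convex_Icc _ _)
  refine measure_mono_null (t := frontier I ∪ frontier J) ?_
    (measure_union_null (hnull hI) (hnull hJ))
  rintro x ⟨hxI, hxJ⟩
  by_contra hx
  rw [Set.mem_union, not_or] at hx
  refine Set.not_disjoint_iff.mpr ⟨x, ?_, ?_⟩ h
  · by_contra hn
    exact hx.1 ⟨subset_closure hxI, hn⟩
  · by_contra hn
    exact hx.2 ⟨subset_closure hxJ, hn⟩

lemma setIntegral_inter_eq_sum {s : ℕ} {J : Fin s → Set (Fin d → ℝ)} {I : Set (Fin d → ℝ)}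
    (hJ : ∀ i, J i ∈ Lambda p)
    (hdisj : ∀ i j, i ≠ j → Disjoint (interior (J i)) (interior (J j))) (hun : ⋃ i, J i = I)
    {E : Set (Fin d → ℝ)} (hE : MeasurableSet E) {F : Type*} [NormedAddCommGroup F]
    [NormedSpace ℝ F] {g : (Fin d → ℝ) → F} (hg : IntegrableOn g I) :
    ∫ x in I ∩ E, g x = ∑ i, ∫ x in J i ∩ E, g x := by
  subst hun
  rw [Set.iUnion_inter, integral_iUnion_ae, tsum_fintype]
  · exact fun i => ((measurableSet_of_mem_Lambda (hJ i)).inter hE).nullMeasurableSet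
  · exact fun i j hij => (aedisjoint_of_disjoint_interior (hJ i) (hJ j) (hdisj i j hij)).mono
      Set.inter_subset_left Set.inter_subset_left
  · rw [← Set.iUnion_inter]
    exact hg.mono_set Set.inter_subset_left

lemma norm_trunc_le {α : Type*} (f : α → ℂ) {lam : α → ℝ} {x : α} (h : 0 ≤ lam x) :
    ‖trunc f lam x‖ ≤ lam x := by
  rw [trunc]
  split_ifs with hx
  · exact hx
  · simpa using h

lemma ghaarNormD_nonneg (p : Fin d → ℕ → ℕ) (n : Fin d → ℕ) : 0 ≤ ghaarNormD p n :=
  Finset.prod_nonneg fun _ _ => Real.sqrt_nonneg _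

lemma measurable_conj_ghaarD (hp : ∀ j i, 2 ≤ p j i) (n : Fin d → ℕ) :
    Measurable fun x => (starRingEnd ℂ) (ghaarD p n x) :=
  Complex.continuous_conj.measurable.comp (measurable_ghaarD hp n)

lemma integrableOn_ghaarSum_mul_conj (hp : ∀ j i, 2 ≤ p j i) (a : (Fin d → ℕ) → ℂ)
    (n : Fin d → ℕ) (N k : ℕ) (c : Fin d → ℤ) :
    IntegrableOn (fun x => ghaarSum p a N x * (starRingEnd ℂ) (ghaarD p n x)) (hcellD p k c) := by
  obtain ⟨B, hB⟩ := norm_ghaarSum_le hp a N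
  refine integrableOn_hcellD_of_bounded hp (B := B * ghaarNormD p n)
    ((measurable_ghaarSum hp a N).mul (measurable_conj_ghaarD hp n)) (fun x => ?_) k c
  rw [Pi.mul_apply, norm_mul, RCLike.norm_conj]
  exact mul_le_mul (hB x) (norm_ghaarD_le hp n x) (norm_nonneg _) ((norm_nonneg _).trans (hB x))

/-- The estimate on one parallelepiped of the decomposition in (h3). -/
lemma norm_setIntegral_cell_inter_le (hp : ∀ j i, 2 ≤ p j i) {M : ℕ} (hM : ∀ j i, p j i ≤ M)
    (a : (Fin d → ℕ) → ℂ) {n : Fin d → ℕ} {K : ℕ}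
    (hn : n ∈ Fintype.piFinset (fun j => Finset.range (mseq (p j) K)))
    {g : (Fin d → ℝ) → ℝ} {C ε δ : ℝ} (hC : 0 < C) (hε : 0 < ε) {k : ℕ} {c : Fin d → ℤ}
    (hg0 : ∀ x ∈ cell p k c, 0 ≤ g x) (hgC : ∀ x ∈ cell p k c, ∀ y ∈ cell p k c, g x ≤ C * g y)
    (hgε : ε ≤ ∫ x in cell p k c, g x) (hgint : IntegrableOn g (cell p k c))
    {E : Set (Fin d → ℝ)} (hE : MeasurableSet E)
    (hSE : ∀ x ∈ cell p k c \ E, ∀ N, ‖ghaarSum p a N x‖ ≤ g x)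
    (hgδ : ∫ x in cell p k c ∩ E, g x ≤ δ) (hδ : 2 * M ^ d * C * δ ≤ ε * vcell p K)
    {N : ℕ} (hkN : k ≤ N) (hKN : K ≤ N) :
    ‖∫ x in cell p k c ∩ E, ghaarSum p a N x * (starRingEnd ℂ) (ghaarD p n x)‖ ≤
      4 * M ^ d * ghaarNormD p n * C * ∫ x in cell p k c ∩ E, g x := by
  have hB := ghaarNormD_nonneg p n
  set B := ghaarNormD p n
  have hne : (g '' cell p k c).Nonempty := by
    refine Set.Nonempty.image g (Set.nonempty_iff_ne_empty.mpr fun h0 => ?_)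
    rw [h0, setIntegral_empty] at hgε
    linarith
  have hbdd : BddBelow (g '' cell p k c) := ⟨0, by rintro _ ⟨x, hx, rfl⟩; exact hg0 x hx⟩
  obtain ⟨l, hl0, hl⟩ : ∃ l, 0 ≤ l ∧ ∀ x ∈ cell p k c, l ≤ g x ∧ g x ≤ C * l := by
    refine ⟨sInf (g '' cell p k c), le_csInf hne (by rintro _ ⟨x, hx, rfl⟩; exact hg0 x hx),
      fun x hx => ⟨csInf_le hbdd ⟨x, hx, rfl⟩, ?_⟩⟩
    rw [← div_le_iff₀' hC]
    refine le_csInf hne ?_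
    rintro _ ⟨y, hy, rfl⟩
    exact (div_le_iff₀' hC).mpr (hgC x hx y hy)
  have hae : (cell p k c ∩ E : Set _) =ᵐ[volume] (hcellD p k c ∩ E : Set _) :=
    (cell_ae_eq_hcellD hp k c).inter (EventuallyEq.refl _ _)
  have hfin : volume (cell p k c) < ⊤ := by
    rw [measure_congr (cell_ae_eq_hcellD hp k c)]
    exact volume_hcellD_lt_top hp k c
  have hmeas : MeasurableSet (cell p k c) := measurableSet_of_mem_Lambda ⟨k, c, rfl⟩
  have hlower : l * volume.real (hcellD p k c ∩ E) ≤ ∫ x in cell p k c ∩ E, g x := by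
    rw [← measureReal_congr hae, mul_comm, ← smul_eq_mul, ← setIntegral_const]
    exact setIntegral_mono_on
      (integrableOn_const ((measure_mono Set.inter_subset_left).trans_lt hfin).ne)
      (hgint.mono_set Set.inter_subset_left) (hmeas.inter hE) fun x hx => (hl x hx.1).1
  have hupper : ε ≤ C * l * vcell p k := by
    refine hgε.trans ?_
    rw [← volume_real_hcellD hp k c, ← measureReal_congr (cell_ae_eq_hcellD hp k c), mul_comm,
      ← smul_eq_mul, ← setIntegral_const]
    exact setIntegral_mono_on hgint (integrableOn_const hfin.ne) hmeas fun x hx => (hl x hx).2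
  have hsmall : 2 * M ^ d * volume.real (hcellD p k c ∩ E) ≤ vcell p (max k K) := by
    have hv : 0 ≤ volume.real (hcellD p k c ∩ E) := measureReal_nonneg
    have hvk := vcell_pos hp k
    have hvK := vcell_pos hp K
    have hmax : vcell p K * vcell p k ≤ vcell p (max k K) := by
      rcases max_choice k K with h | h <;> rw [h]
      · nlinarith [vcell_le_one hp K]
      · nlinarith [vcell_le_one hp k]
    refine le_of_mul_le_mul_left ?_ hε
    calc ε * (2 * M ^ d * volume.real (hcellD p k c ∩ E))
        ≤ C * l * vcell p k * (2 * M ^ d * volume.real (hcellD p k c ∩ E)) := by gcongr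
      _ = 2 * M ^ d * C * (l * volume.real (hcellD p k c ∩ E)) * vcell p k := by ring
      _ ≤ 2 * M ^ d * C * δ * vcell p k := by gcongr; exact hlower.trans hgδ
      _ ≤ ε * vcell p K * vcell p k := by gcongr
      _ ≤ ε * vcell p (max k K) := by rw [mul_assoc]; gcongr
  obtain ⟨j, rfl⟩ := Nat.exists_eq_add_of_le hkN
  rw [setIntegral_congr_set hae]
  refine (norm_setIntegral_hcellD_inter_le hp hM
    (G := fun N x => ghaarSum p a N x * (starRingEnd ℂ) (ghaarD p n x)) (K := K) (H := C * l * B)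
    ?_ ?_ (fun N i c => integrableOn_ghaarSum_mul_conj hp a n N i c) hE (by positivity) j k c hKN
    ?_ hsmall).trans ?_
  · intro N hN c x hx y hy
    simp only [ghaarSum_congr hp a hx hy, ghaarD_congr hp (piFinset_range_mseq_subset hp hN hn) hx hy]
  · intro i hi N hN c
    obtain ⟨z, hz⟩ : ∃ z, ∀ x ∈ hcellD p i c, (starRingEnd ℂ) (ghaarD p n x) = z := by
      rcases (hcellD p i c).eq_empty_or_nonempty with h | ⟨y, hy⟩
      · exact ⟨0, by simp [h]⟩
      · exact ⟨_, fun x hx => by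
          rw [ghaarD_congr hp (piFinset_range_mseq_subset hp hi hn) hx hy]⟩
    have hz' : ∀ N, ∫ x in hcellD p i c, ghaarSum p a N x * (starRingEnd ℂ) (ghaarD p n x) =
        (∫ x in hcellD p i c, ghaarSum p a N x) * z := fun N => by
      rw [← integral_mul_const]
      exact setIntegral_congr_fun (measurableSet_hcellD _ _ _) fun x hx => by simp only [hz x hx]
    rw [hz', hz', setIntegral_ghaarSum hp a hN]
  · intro N _ x hx
    have hx' := hcellD_subset_cell hp k c hx.1
    rw [norm_mul, RCLike.norm_conj]
    exact mul_le_mul ((hSE x ⟨hx', hx.2⟩ N).trans (hl x hx').2) (norm_ghaarD_le hp n x)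
      (norm_nonneg _) (by positivity)
  · calc 4 * M ^ d * (C * l * B) * volume.real (hcellD p k c ∩ E)
        = 4 * M ^ d * B * C * (l * volume.real (hcellD p k c ∩ E)) := by ring
      _ ≤ _ := by gcongr

/-- The quantitative form of the recovery of coefficients. -/
lemma norm_coeff_sub_integral_trunc_le (hp : ∀ j i, 2 ≤ p j i) {M : ℕ} (hM : ∀ j i, p j i ≤ M)
    (a : (Fin d → ℕ) → ℂ) {f : (Fin d → ℝ) → ℂ}
    (hconv : ∀ᵐ x ∂(volume.restrict (Set.Icc (0 : Fin d → ℝ) 1)),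
      Tendsto (fun N => ghaarSum p a N x) atTop (𝓝 (f x)))
    {n : Fin d → ℕ} {K : ℕ} (hn : n ∈ Fintype.piFinset (fun j => Finset.range (mseq (p j) K)))
    {g : (Fin d → ℝ) → ℝ} {C ε : ℝ} (hC : 0 < C) (hε : 0 < ε)
    (hg0 : ∀ x ∈ Set.Icc (0 : Fin d → ℝ) 1, 0 ≤ g x)
    {s : ℕ} {J : Fin s → Set (Fin d → ℝ)} (hJ : ∀ i, J i ∈ Lambda p)
    (hdisj : ∀ i j, i ≠ j → Disjoint (interior (J i)) (interior (J j)))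
    (hun : ⋃ i, J i = Set.Icc (0 : Fin d → ℝ) 1)
    (hgC : ∀ i, ∀ x ∈ J i, ∀ y ∈ J i, g x ≤ C * g y) (hgε : ∀ i, ε ≤ ∫ x in J i, g x)
    (hδ : 2 * M ^ d * C * (∫ x in {x ∈ Set.Icc (0 : Fin d → ℝ) 1 |
      ∃ N, g x < ‖ghaarSum p a N x‖}, g x) ≤ ε * vcell p K) :
    ‖(∫ x in Set.Icc (0 : Fin d → ℝ) 1, trunc (fun y => f y * (starRingEnd ℂ) (ghaarD p n y))
        (fun y => ghaarNormD p n * g y) x) - a n‖ ≤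
      (4 * M ^ d * C + 1) * ghaarNormD p n *
        ∫ x in {x ∈ Set.Icc (0 : Fin d → ℝ) 1 | ∃ N, g x < ‖ghaarSum p a N x‖}, g x := by
  have hB := ghaarNormD_nonneg p n
  set B := ghaarNormD p n
  set φ : (Fin d → ℝ) → ℂ := fun x => (starRingEnd ℂ) (ghaarD p n x)
  have hφB : ∀ x, ‖φ x‖ ≤ B := fun x => by
    rw [RCLike.norm_conj]
    exact norm_ghaarD_le hp n x
  have hφ : Measurable φ := measurable_conj_ghaarD hp n
  set I := Set.Icc (0 : Fin d → ℝ) 1 with hI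
  have hImeas : MeasurableSet I := measurableSet_Icc
  have hIae : I =ᵐ[volume] hcellD p 0 0 := by
    rw [hI, Icc_zero_one_eq_cell p]
    exact cell_ae_eq_hcellD hp 0 0
  have hJI : ∀ i, J i ⊆ I := fun i => hun ▸ Set.subset_iUnion J i
  have hgI : IntegrableOn g I := by
    rw [← hun, integrableOn_finite_iUnion]
    intro i
    by_contra h0
    have := hgε i
    rw [integral_undef h0] at this
    linarith
  have hgm := hgI.aestronglyMeasurable
  obtain ⟨E, hsub, hE, hEae⟩ : ∃ E ⊇ {x ∈ I | ∃ N, g x < ‖ghaarSum p a N x‖},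
      MeasurableSet E ∧ E =ᵐ[volume] {x ∈ I | ∃ N, g x < ‖ghaarSum p a N x‖} := by
    refine NullMeasurableSet.exists_measurable_superset_ae_eq ?_
    have hset : {x ∈ I | ∃ N, g x < ‖ghaarSum p a N x‖} =
        (⋃ N, {x | g x < ‖ghaarSum p a N x‖}) ∩ I := by
      ext x
      simp [and_comm]
    rw [hset, ← nullMeasurableSet_restrict hImeas.nullMeasurableSet]
    exact NullMeasurableSet.iUnion fun N => nullMeasurableSet_lt hgm.aemeasurable
      (measurable_ghaarSum hp a N).norm.aemeasurable
  have hδE : ∫ x in {x ∈ I | ∃ N, g x < ‖ghaarSum p a N x‖}, g x = ∫ x in I ∩ E, g x := by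
    refine (setIntegral_congr_set ?_).symm
    refine ((EventuallyEq.refl _ I).inter hEae).trans ?_
    exact (Set.inter_eq_right.mpr fun x hx => hx.1).eventuallyEq
  rw [hδE] at hδ ⊢
  have hSE : ∀ x ∈ I \ E, ∀ N, ‖ghaarSum p a N x‖ ≤ g x := by
    intro x hx N
    by_contra! hlt
    exact hx.2 (hsub ⟨hx.1, N, hlt⟩)
  have hFint : ∀ N, IntegrableOn (fun x => ghaarSum p a N x * φ x) I := fun N =>
    (integrableOn_ghaarSum_mul_conj hp a n N 0 0).congr_set_ae hIae
  choose k c hkc using hJ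
  have hδi : ∀ i, ∫ x in J i ∩ E, g x ≤ ∫ x in I ∩ E, g x := fun i =>
    setIntegral_mono_set (hgI.mono_set Set.inter_subset_left)
      ((ae_restrict_iff' (hImeas.inter hE)).mpr (Eventually.of_forall fun x hx => hg0 x hx.1))
      (Set.inter_subset_inter_left E (hJI i)).eventuallyLE
  have hN : ∀ N ≥ K + ∑ i, k i, ‖(∫ x in I \ E, ghaarSum p a N x * φ x) - a n‖ ≤
      4 * M ^ d * B * C * ∫ x in I ∩ E, g x := by
    intro N hN
    have hcoeff : ∫ x in I, ghaarSum p a N x * φ x = a n := by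
      rw [setIntegral_congr_set hIae]
      exact setIntegral_ghaarSum_mul_conj hp a
        (piFinset_range_mseq_subset hp (by omega : K ≤ N) hn)
    rw [← hcoeff, ← integral_inter_add_sdiff hE (hFint N), sub_add_cancel_right, norm_neg,
      setIntegral_inter_eq_sum (fun i => ⟨k i, c i, hkc i⟩) hdisj hun hE (hFint N),
      setIntegral_inter_eq_sum (fun i => ⟨k i, c i, hkc i⟩) hdisj hun hE hgI, Finset.mul_sum]
    refine (norm_sum_le _ _).trans (Finset.sum_le_sum fun i _ => ?_)
    have hki : k i ≤ ∑ i, k i := Finset.single_le_sum (fun _ _ => Nat.zero_le _) (Finset.mem_univ i)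
    have hJi := hJI i
    have hgCi := hgC i
    have hgεi := hgε i
    have hδii := hδi i
    rw [hkc i] at hJi hgCi hgεi hδii ⊢
    exact norm_setIntegral_cell_inter_le hp hM a hn hC hε (fun x hx => hg0 x (hJi hx)) hgCi hgεi
      (hgI.mono_set hJi) hE (fun x hx => hSE x ⟨hJi hx.1, hx.2⟩) hδii hδ (by omega) (by omega)
  have hfm : AEStronglyMeasurable f (volume.restrict I) :=
    aestronglyMeasurable_of_tendsto_ae atTop
      (fun N => (measurable_ghaarSum hp a N).aestronglyMeasurable) hconv
  have hconvE : ∀ᵐ x ∂(volume.restrict (I \ E)),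
      Tendsto (fun N => ghaarSum p a N x) atTop (𝓝 (f x)) :=
    ae_restrict_of_ae_restrict_of_subset Set.sdiff_subset hconv
  have hlim : Tendsto (fun N => ∫ x in I \ E, ghaarSum p a N x * φ x) atTop
      (𝓝 (∫ x in I \ E, f x * φ x)) := by
    refine tendsto_integral_of_dominated_convergence (fun x => g x * B)
      (fun N => ((measurable_ghaarSum hp a N).mul hφ).aestronglyMeasurable)
      ((hgI.mono_set Set.sdiff_subset).mul_const B) (fun N => ?_) ?_
    · refine (ae_restrict_iff' (hImeas.diff hE)).mpr (Eventually.of_forall fun x hx => ?_)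
      rw [norm_mul]
      exact mul_le_mul (hSE x hx N) (hφB x) (norm_nonneg _) (hg0 x hx.1)
    · filter_upwards [hconvE] with x hx using hx.mul_const _
  have hmain : ‖(∫ x in I \ E, f x * φ x) - a n‖ ≤ 4 * M ^ d * B * C * ∫ x in I ∩ E, g x :=
    le_of_tendsto (hlim.sub_const _).norm (eventually_atTop.mpr ⟨_, hN⟩)
  have htrunc_le : ∀ x ∈ I, ‖trunc (fun y => f y * φ y) (fun y => B * g y) x‖ ≤ B * g x :=
    fun x hx => norm_trunc_le _ (mul_nonneg hB (hg0 x hx))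
  have htrunc_int : IntegrableOn (trunc (fun y => f y * φ y) fun y => B * g y) I := by
    refine Integrable.mono' (hgI.const_mul B) ?_
      ((ae_restrict_iff' hImeas).mpr (Eventually.of_forall htrunc_le))
    have hfφ : AEStronglyMeasurable (fun y => f y * φ y) (volume.restrict I) :=
      hfm.mul hφ.aestronglyMeasurable
    have hind : (trunc (fun y => f y * φ y) fun y => B * g y) =
        {x | ‖f x * φ x‖ ≤ B * g x}.indicator fun y => f y * φ y := by
      ext x
      simp [trunc, Set.indicator_apply]
    rw [hind]
    exact hfφ.indicator₀ (nullMeasurableSet_le hfφ.norm.aemeasurable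
      (hgm.aemeasurable.const_mul B))
  have htrunc_eq : ∫ x in I \ E, trunc (fun y => f y * φ y) (fun y => B * g y) x =
      ∫ x in I \ E, f x * φ x := by
    refine integral_congr_ae ?_
    filter_upwards [hconvE, ae_restrict_mem (hImeas.diff hE)] with x hx hxE
    have hfx : ‖f x‖ ≤ g x := le_of_tendsto' hx.norm (hSE x hxE)
    refine if_pos ?_
    rw [norm_mul]
    refine le_of_le_of_eq ?_ (mul_comm (g x) B)
    exact mul_le_mul hfx (hφB x) (norm_nonneg _) (hg0 x hxE.1)
  have htruncE : ‖∫ x in I ∩ E, trunc (fun y => f y * φ y) (fun y => B * g y) x‖ ≤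
      B * ∫ x in I ∩ E, g x := by
    rw [← integral_const_mul]
    exact norm_integral_le_of_norm_le ((hgI.mono_set Set.inter_subset_left).const_mul B)
      ((ae_restrict_iff' (hImeas.inter hE)).mpr
        (Eventually.of_forall fun x hx => htrunc_le x hx.1))
  rw [← integral_inter_add_sdiff hE htrunc_int, htrunc_eq, add_sub_assoc]
  refine (norm_add_le _ _).trans ((add_le_add htruncE hmain).trans_eq ?_)
  ring

end Recovery

/-- **Theorem (recovery of the coefficients of a multiple generalized Haar series).**
Let the `𝒫`-adic partial sums `S_N = ∑_{n̄ < Ñ} a_{n̄} χ^𝒫_{n̄}` converge a.e. on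
`[0,1]ᵈ` to `f`, with `sup_{i,j} pʲᵢ ≤ M < ∞`.  If `{h m}` satisfies (h1)–(h3) on
`[0,1]ᵈ` and `∫_{{Ψ* > h m}} h m → 0`, where `Ψ*(x) = sup_N |S_N(x)|`, then for every
`n̄ ∈ ℤ₊ᵈ`, `a_{n̄} = lim_m ∫_{[0,1]ᵈ} [f · conj (χ^𝒫_{n̄})]_{‖χ^𝒫_{n̄}‖_∞ · h m}`. -/
theorem coefficient_recovery_generalized_haar
    (d : ℕ) (p : Fin d → ℕ → ℕ) (hp : ∀ j i, 2 ≤ p j i)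
    (M : ℕ) (hM : ∀ j i, p j i ≤ M)
    (a : (Fin d → ℕ) → ℂ) (f : (Fin d → ℝ) → ℂ)
    (hconv : ∀ᵐ x ∂(volume.restrict (Set.Icc (0 : Fin d → ℝ) 1)),
      Tendsto (fun N => ghaarSum p a N x) atTop (𝓝 (f x)))
    (h : ℕ → (Fin d → ℝ) → ℝ) (hh : HConds p (Set.Icc (0 : Fin d → ℝ) 1) h)
    (hsmall : Tendsto (fun m =>
        ∫ x in {x ∈ Set.Icc (0 : Fin d → ℝ) 1 | ∃ N, h m x < ‖ghaarSum p a N x‖},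
          h m x)
      atTop (𝓝 0)) :
    ∀ n : Fin d → ℕ,
      Tendsto (fun m => ∫ x in Set.Icc (0 : Fin d → ℝ) 1,
          trunc (fun y => f y * (starRingEnd ℂ) (ghaarD p n y))
            (fun y => ghaarNormD p n * h m y) x)
        atTop (𝓝 (a n)) := by
  intro n
  obtain ⟨hmono, C, hC, ε, hε, hdec⟩ := hh
  obtain ⟨K, hK⟩ : ∃ K, n ∈ Fintype.piFinset (fun j => Finset.range (mseq (p j) K)) := by
    refine ⟨∑ j, n j, Fintype.mem_piFinset.mpr fun j => Finset.mem_range.mpr ?_⟩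
    exact (Finset.single_le_sum (fun _ _ => Nat.zero_le _) (Finset.mem_univ j)).trans_lt
      (lt_mseq (hp j) _)
  rw [tendsto_iff_norm_sub_tendsto_zero]
  have hlim := hsmall.const_mul ((4 * (M : ℝ) ^ d * C + 1) * ghaarNormD p n)
  have hδ := hsmall.const_mul (2 * (M : ℝ) ^ d * C)
  rw [mul_zero] at hlim hδ
  refine squeeze_zero' (Eventually.of_forall fun _ => norm_nonneg _) ?_ hlim
  filter_upwards [hδ.eventually_le_const (mul_pos hε (vcell_pos hp K))] with m hm
  obtain ⟨s, J, hJ, hdisj, hun, hhC, hhε⟩ := hdec m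
  exact norm_coeff_sub_integral_trunc_le hp hM a hconv hK hC hε (fun x hx => (hmono x hx).1 m) hJ
    hdisj hun hhC hhε hm
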